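/- Let $\xi$ be an integer-valued random variable with mean $0$, $\xi \le 1$ a.s., and $\mathbb{P}(\xi = -k) \sim c k^{-5/2}$ as $k \to \infty$ for some $c > 0$. Then $\mathbb{E}[e^{x\xi}] - 1 \sim C x^{3/2}$ as $x \downarrow 0$ for some constant $C > 0$. -/

import Mathlib

open MeasureTheory ProbabilityTheory Filter

/-- The kernel `u^{-5/2} (e^{-u} - 1 + u)`. -/
noncomputable def lapH (u : ℝ) : ℝ := u ^ (-(5 : ℝ) / 2) * (Real.exp (-u) - 1 + u)

/-- The dominating function. -/
noncomputable def lapB (t : ℝ) : ℝ := if t ≤ 1 then t ^ (-(1 : ℝ) / 2) else t ^ (-(3 : ℝ) / 2)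

lemma lapH_pos {u : ℝ} (hu : 0 < u) : 0 < lapH u := by
  unfold lapH
  have := Real.add_one_lt_exp (x := -u) (by linarith)
  have h2 : 0 < Real.exp (-u) - 1 + u := by linarith
  positivity

lemma lapH_le {t u : ℝ} (ht : 0 < t) (htu : t ≤ u) : lapH u ≤ lapB t := by
  have hu : 0 < u := by linarith
  have h1 : Real.exp (-u) - 1 + u ≤ u := by
    have : Real.exp (-u) ≤ 1 := Real.exp_le_one_iff.2 (by linarith)
    linarith
  have h2 : Real.exp (-u) - 1 + u ≤ u ^ 2 := by
    rcases le_or_gt u 1 with h | h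
    · have := Real.abs_exp_sub_one_sub_id_le (x := -u) (by rw [abs_neg, abs_of_pos hu]; exact h)
      have := (abs_le.1 this).2
      nlinarith
    · nlinarith
  unfold lapH lapB
  split_ifs with h
  · calc u ^ (-(5 : ℝ) / 2) * (Real.exp (-u) - 1 + u) ≤ u ^ (-(5 : ℝ) / 2) * u ^ 2 := by gcongr
      _ = u ^ (-(1 : ℝ) / 2) := by
        rw [← Real.rpow_natCast, ← Real.rpow_add hu]; norm_num
      _ ≤ _ := Real.rpow_le_rpow_of_nonpos ht htu (by norm_num)
  · calc u ^ (-(5 : ℝ) / 2) * (Real.exp (-u) - 1 + u) ≤ u ^ (-(5 : ℝ) / 2) * u := by gcongr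
      _ = u ^ (-(3 : ℝ) / 2) := by
        nth_rewrite 2 [← Real.rpow_one u]
        rw [← Real.rpow_add hu]; norm_num
      _ ≤ _ := Real.rpow_le_rpow_of_nonpos ht htu (by norm_num)

lemma lapB_integrable : IntegrableOn lapB (Set.Ioi 0) := by
  rw [← Set.Ioc_union_Ioi_eq_Ioi (zero_le_one (α := ℝ))]
  refine IntegrableOn.union ?_ ?_
  · have : IntegrableOn (fun t : ℝ => t ^ (-(1 : ℝ) / 2)) (Set.Ioc 0 1) := by
      rw [← intervalIntegrable_iff_integrableOn_Ioc_of_le zero_le_one]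
      exact intervalIntegral.intervalIntegrable_rpow' (by norm_num)
    refine this.congr_fun (fun t ht => ?_) measurableSet_Ioc
    simp [lapB, ht.2]
  · have : IntegrableOn (fun t : ℝ => t ^ (-(3 : ℝ) / 2)) (Set.Ioi 1) :=
      integrableOn_Ioi_rpow_of_lt (by norm_num) one_pos
    refine this.congr_fun (fun t ht => ?_) measurableSet_Ioi
    simp [lapB, not_le.2 (Set.mem_Ioi.1 ht)]

lemma lapH_meas : Measurable lapH := by
  unfold lapH
  fun_prop

lemma lapH_cont {t : ℝ} (ht : 0 < t) : ContinuousAt lapH t := by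
  unfold lapH
  have : ContinuousAt (fun u : ℝ => u ^ (-(5 : ℝ) / 2)) t :=
    Real.continuousAt_rpow_const _ _ (Or.inl ht.ne')
  exact this.mul (by fun_prop)

lemma lapH_integrable : IntegrableOn lapH (Set.Ioi 0) := by
  refine Integrable.mono' lapB_integrable lapH_meas.aestronglyMeasurable ?_
  refine (ae_restrict_iff' measurableSet_Ioi).2 (Eventually.of_forall fun t ht => ?_)
  rw [Real.norm_of_nonneg (lapH_pos ht).le]
  exact lapH_le ht le_rfl

lemma lapH_integral_pos : 0 < ∫ t in Set.Ioi 0, lapH t := by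
  rw [setIntegral_pos_iff_support_of_nonneg_ae _ lapH_integrable]
  · have : Function.support lapH ∩ Set.Ioi 0 = Set.Ioi 0 :=
      Set.inter_eq_right.2 fun t ht => (lapH_pos ht).ne'
    rw [this]; simp
  · exact (ae_restrict_iff' measurableSet_Ioi).2
      (Eventually.of_forall fun t ht => (lapH_pos ht).le)

/-- The step function. -/
noncomputable def lapF (a : ℕ → ℝ) (x t : ℝ) : ℝ := a ⌈t / x⌉₊ * lapH (x * ⌈t / x⌉₊)

lemma lapF_meas (a : ℕ → ℝ) (x : ℝ) : Measurable (lapF a x) := by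
  have hc : Measurable (fun t : ℝ => ⌈t / x⌉₊) := Nat.measurable_ceil.comp (by fun_prop)
  have : Measurable (fun n : ℕ => a n * lapH (x * n)) := measurable_from_nat
  exact this.comp hc

lemma lapF_le {a : ℕ → ℝ} (ha : ∀ k, 0 ≤ a k) {M : ℝ} (hM : ∀ k, a k ≤ M) {x t : ℝ}
    (hx : 0 < x) (ht : 0 < t) : ‖lapF a x t‖ ≤ M * lapB t := by
  have h1 : t ≤ x * ⌈t / x⌉₊ := by
    have := Nat.le_ceil (t / x)
    rw [div_le_iff₀ hx] at this
    linarith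
  have hp := lapH_pos (ht.trans_le h1)
  unfold lapF
  rw [Real.norm_of_nonneg (mul_nonneg (ha _) hp.le)]
  exact mul_le_mul (hM _) (lapH_le ht h1) hp.le ((ha 0).trans (hM 0))

lemma lapF_integrable {a : ℕ → ℝ} (ha : ∀ k, 0 ≤ a k) {M : ℝ} (hM : ∀ k, a k ≤ M) {x : ℝ}
    (hx : 0 < x) : IntegrableOn (lapF a x) (Set.Ioi 0) := by
  refine Integrable.mono' (lapB_integrable.const_mul M) (lapF_meas a x).aestronglyMeasurable ?_
  exact (ae_restrict_iff' measurableSet_Ioi).2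
    (Eventually.of_forall fun t ht => lapF_le ha hM hx ht)

lemma lapF_tendsto {a : ℕ → ℝ} (ha : ∀ k, 0 ≤ a k) {M : ℝ} (hM : ∀ k, a k ≤ M) {c : ℝ}
    (hac : Tendsto a atTop (nhds c)) :
    Tendsto (fun x => ∫ t in Set.Ioi 0, lapF a x t) (nhdsWithin 0 (Set.Ioi 0))
      (nhds (∫ t in Set.Ioi 0, c * lapH t)) := by
  refine tendsto_integral_filter_of_dominated_convergence (fun t => M * lapB t) ?_ ?_
    (lapB_integrable.const_mul M) ?_
  · exact Eventually.of_forall fun x => (lapF_meas a x).aestronglyMeasurable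
  · filter_upwards [self_mem_nhdsWithin] with x hx
    exact (ae_restrict_iff' measurableSet_Ioi).2
      (Eventually.of_forall fun t ht => lapF_le ha hM hx ht)
  · refine (ae_restrict_iff' measurableSet_Ioi).2 (Eventually.of_forall fun t ht => ?_)
    have ht : 0 < t := ht
    have hdiv : Tendsto (fun x : ℝ => t / x) (nhdsWithin 0 (Set.Ioi 0)) atTop := by
      simp only [div_eq_mul_inv]
      exact tendsto_inv_nhdsGT_zero.const_mul_atTop ht
    have hceil : Tendsto (fun x : ℝ => ⌈t / x⌉₊) (nhdsWithin 0 (Set.Ioi 0)) atTop :=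
      tendsto_nat_ceil_atTop.comp hdiv
    have hu : Tendsto (fun x : ℝ => x * (⌈t / x⌉₊ : ℝ)) (nhdsWithin 0 (Set.Ioi 0)) (nhds t) := by
      have hid : Tendsto (fun x : ℝ => t + x) (nhdsWithin 0 (Set.Ioi 0)) (nhds t) := by
        have : Tendsto (fun x : ℝ => t + x) (nhds 0) (nhds (t + 0)) :=
          Continuous.tendsto (by fun_prop) 0
        rw [add_zero] at this
        exact this.mono_left nhdsWithin_le_nhds
      refine tendsto_of_tendsto_of_tendsto_of_le_of_le' tendsto_const_nhds hid ?_ ?_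
      · filter_upwards [self_mem_nhdsWithin] with x hx
        have hx : 0 < x := hx
        have := Nat.le_ceil (t / x)
        rw [div_le_iff₀ hx] at this
        linarith
      · filter_upwards [self_mem_nhdsWithin] with x hx
        have hx : 0 < x := hx
        have := Nat.ceil_lt_add_one (a := t / x) (by positivity)
        have h2 : x * (⌈t / x⌉₊ : ℝ) ≤ x * (t / x + 1) := by gcongr
        have h3 : x * (t / x + 1) = t + x := by field_simp
        linarith
    exact (hac.comp hceil).mul ((lapH_cont ht).tendsto.comp hu)

lemma lapF_hasSum {a : ℕ → ℝ} (ha : ∀ k, 0 ≤ a k) {M : ℝ} (hM : ∀ k, a k ≤ M) {x : ℝ}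
    (hx : 0 < x) : HasSum (fun n : ℕ => x * (a (n + 1) * lapH (x * ((n : ℝ) + 1))))
      (∫ t in Set.Ioi 0, lapF a x t) := by
  have key : ∀ n : ℕ, ∀ t ∈ Set.Ioc (n * x) (((n : ℝ) + 1) * x), ⌈t / x⌉₊ = n + 1 := by
    intro n t ht
    rw [Nat.ceil_eq_iff (by omega)]
    constructor
    · rw [lt_div_iff₀ hx]; simpa using ht.1
    · rw [div_le_iff₀ hx]; simpa using ht.2
  have hU : (⋃ n : ℕ, Set.Ioc (n * x) (((n : ℝ) + 1) * x)) = Set.Ioi 0 := by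
    ext t
    simp only [Set.mem_iUnion, Set.mem_Ioi]
    constructor
    · rintro ⟨n, hn⟩
      exact lt_of_le_of_lt (by positivity) hn.1
    · intro ht
      have hp : 0 < ⌈t / x⌉₊ := Nat.ceil_pos.2 (by positivity)
      obtain ⟨m, hm⟩ := Nat.exists_eq_succ_of_ne_zero hp.ne'
      have h := (Nat.ceil_eq_iff (by omega)).1 hm
      refine ⟨m, ?_, ?_⟩
      · have := h.1; rw [lt_div_iff₀ hx] at this; simpa using this
      · have := h.2; rw [div_le_iff₀ hx] at this; simpa using this
  have := hasSum_integral_iUnion (μ := volume) (f := lapF a x)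
    (s := fun n : ℕ => Set.Ioc (n * x) (((n : ℝ) + 1) * x)) (fun _ => measurableSet_Ioc) ?_ ?_
  · rw [hU] at this
    refine (congrArg (fun f : ℕ → ℝ => HasSum f _) (funext fun n => ?_)).mpr this
    rw [setIntegral_congr_fun (g := fun _ => a (n + 1) * lapH (x * ((n : ℝ) + 1)))
      measurableSet_Ioc]
    · rw [setIntegral_const, smul_eq_mul, Measure.real, Real.volume_Ioc,
        ENNReal.toReal_ofReal (by nlinarith)]
      ring
    · intro t ht
      simp only [lapF, key n t ht]
      push_cast; rfl
  · intro m n hmn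
    refine Set.disjoint_left.2 fun t h1 h2 => hmn ?_
    have := (key m t h1).symm.trans (key n t h2)
    omega
  · rw [hU]; exact lapF_integrable ha hM hx

theorem laplace_transform_asymptotics
    {Ω : Type*} [MeasureSpace Ω] [IsProbabilityMeasure (ℙ : Measure Ω)]
    (ξ : Ω → ℤ) (c : ℝ) (hc : 0 < c)
    (hmeas : Measurable ξ)
    (hbound : ∀ᵐ ω ∂(ℙ : Measure Ω), ξ ω ≤ 1)
    (hint : Integrable (fun ω => (ξ ω : ℝ)) ℙ)
    (hmean : ∫ ω, (ξ ω : ℝ) ∂ℙ = 0)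
    (htail : Tendsto
      (fun k : ℕ => (ℙ {ω | ξ ω = -(k : ℤ)}).toReal * (k : ℝ) ^ ((5 : ℝ) / 2))
      atTop (nhds c)) :
    ∃ C > 0, Tendsto
      (fun x : ℝ => ((∫ ω, Real.exp (x * (ξ ω : ℝ)) ∂ℙ) - 1) / x ^ ((3 : ℝ) / 2))
      (nhdsWithin 0 (Set.Ioi 0)) (nhds C) := by
  set a : ℕ → ℝ := fun k => (ℙ {ω | ξ ω = -(k : ℤ)}).toReal * (k : ℝ) ^ ((5 : ℝ) / 2) with hadef
  have ha : ∀ k, 0 ≤ a k := fun k => by simp only [hadef]; positivity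
  obtain ⟨M, hM⟩ := htail.bddAbove_range
  have hM : ∀ k, a k ≤ M := fun k => hM ⟨k, rfl⟩
  refine ⟨∫ t in Set.Ioi 0, c * lapH t, ?_, ?_⟩
  · rw [integral_const_mul]
    exact mul_pos hc lapH_integral_pos
  have hT := lapF_tendsto ha hM htail
  set A : Set Ω := ⋃ n : ℕ, {ω | ξ ω = -((n + 1 : ℕ) : ℤ)} with hA
  have hAn : ∀ n : ℕ, MeasurableSet {ω | ξ ω = -((n + 1 : ℕ) : ℤ)} := fun n =>
    hmeas (measurableSet_singleton _)
  have hAm : MeasurableSet A := MeasurableSet.iUnion hAn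
  -- decomposition
  have hdec : ∀ x : ℝ, 0 < x → x ≤ 1 →
      ‖((∫ ω, Real.exp (x * (ξ ω : ℝ)) ∂ℙ) - 1) / x ^ ((3 : ℝ) / 2)
        - ∫ t in Set.Ioi 0, lapF a x t‖ ≤ x ^ ((1 : ℝ) / 2) := by
    intro x hx hx1
    have hexp : Integrable (fun ω => Real.exp (x * (ξ ω : ℝ))) ℙ := by
      refine Integrable.of_bound (C := Real.exp x) ?_ ?_
      · have : Measurable (fun n : ℤ => Real.exp (x * (n : ℝ))) := measurable_from_top
        exact (this.comp hmeas).aestronglyMeasurable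
      · filter_upwards [hbound] with ω hω
        rw [Real.norm_of_nonneg (Real.exp_pos _).le]
        have : (ξ ω : ℝ) ≤ 1 := by exact_mod_cast hω
        exact Real.exp_le_exp.2 (by nlinarith)
    set φ : Ω → ℝ := fun ω => Real.exp (x * (ξ ω : ℝ)) - 1 - x * (ξ ω : ℝ) with hφ
    have hφi : Integrable φ ℙ := (hexp.sub (integrable_const 1)).sub (hint.const_mul x)
    have hφint : ∫ ω, φ ω ∂ℙ = (∫ ω, Real.exp (x * (ξ ω : ℝ)) ∂ℙ) - 1 := by
      simp only [hφ]
      have hsub : Integrable (fun ω => Real.exp (x * (ξ ω : ℝ)) - 1) ℙ :=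
        hexp.sub (integrable_const 1)
      rw [integral_sub hsub (hint.const_mul x),
        integral_sub hexp (integrable_const 1), integral_const_mul, hmean]
      simp
    have hsplit := integral_add_compl hAm hφi
    have hsum1 : HasSum (fun n : ℕ => ∫ ω in {ω | ξ ω = -((n + 1 : ℕ) : ℤ)}, φ ω ∂ℙ)
        (∫ ω in A, φ ω ∂ℙ) := by
      refine hasSum_integral_iUnion hAn ?_ hφi.integrableOn
      intro m n hmn
      refine Set.disjoint_left.2 fun t h1 h2 => hmn ?_
      simp only [Set.mem_ofPred_eq] at h1 h2
      omega
    have hsum2 := (lapF_hasSum ha hM hx).mul_left (x ^ ((3 : ℝ) / 2))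
    have heq : ∫ ω in A, φ ω ∂ℙ = x ^ ((3 : ℝ) / 2) * ∫ t in Set.Ioi 0, lapF a x t := by
      refine hsum1.unique ?_
      refine (congrArg (fun f : ℕ → ℝ => HasSum f _) (funext fun n => ?_)).mpr hsum2
      rw [setIntegral_congr_fun
        (g := fun _ => Real.exp (-(x * ((n : ℝ) + 1))) - 1 + x * ((n : ℝ) + 1)) (hAn n)]
      · rw [setIntegral_const, smul_eq_mul, Measure.real]
        simp only [hadef, lapH]
        have hn : (0 : ℝ) < (n : ℝ) + 1 := by positivity
        have e1 : x ^ ((3 : ℝ) / 2) * x * x ^ (-(5 : ℝ) / 2) = 1 := by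
          nth_rewrite 2 [← Real.rpow_one x]
          rw [← Real.rpow_add hx, ← Real.rpow_add hx]; norm_num
        have e2 : ((n : ℝ) + 1) ^ ((5 : ℝ) / 2) * ((n : ℝ) + 1) ^ (-(5 : ℝ) / 2) = 1 := by
          rw [← Real.rpow_add hn]; norm_num
        rw [Real.mul_rpow hx.le hn.le]
        push_cast
        generalize (ℙ {ω | ξ ω = -((n : ℤ) + 1)}).toReal = P
        generalize Real.exp (-(x * ((n : ℝ) + 1))) - 1 + x * ((n : ℝ) + 1) = G
        linear_combination (-(P * G)) * e1 - P * G *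
          (x ^ ((3 : ℝ) / 2) * x * x ^ (-(5 : ℝ) / 2)) * e2
      · intro ω hω
        have hω : ξ ω = -((n + 1 : ℕ) : ℤ) := hω
        simp only [hφ, hω]
        push_cast
        ring_nf
    have hrem : ‖∫ ω in Aᶜ, φ ω ∂ℙ‖ ≤ x ^ 2 := by
      have h := norm_setIntegral_le_of_norm_le_const_ae' (μ := (ℙ : Measure Ω)) (s := Aᶜ)
        (f := φ) (C := x ^ 2) (measure_lt_top _ _) ?_
      · refine h.trans ?_
        have : (ℙ : Measure Ω).real Aᶜ ≤ 1 := measureReal_le_one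
        nlinarith [sq_nonneg x]
      · filter_upwards [hbound] with ω hω hωA
        have h01 : ξ ω = 0 ∨ ξ ω = 1 := by
          by_contra hne
          apply hωA
          refine Set.mem_iUnion.2 ⟨(-ξ ω - 1).toNat, ?_⟩
          simp only [Set.mem_ofPred_eq]
          omega
        rcases h01 with h | h
        · simp only [hφ, h]; simp; positivity
        · simp only [hφ, h]
          have := Real.abs_exp_sub_one_sub_id_le (x := x) (by rwa [abs_of_pos hx])
          simpa using this
    have hx3 : 0 < x ^ ((3 : ℝ) / 2) := by positivity
    have : ((∫ ω, Real.exp (x * (ξ ω : ℝ)) ∂ℙ) - 1) / x ^ ((3 : ℝ) / 2)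
        - ∫ t in Set.Ioi 0, lapF a x t = (∫ ω in Aᶜ, φ ω ∂ℙ) / x ^ ((3 : ℝ) / 2) := by
      rw [← hφint, ← hsplit, heq]
      field_simp
      ring
    rw [this, norm_div, Real.norm_of_nonneg hx3.le, div_le_iff₀ hx3, ← Real.rpow_add hx]
    norm_num
    simpa using hrem
  have hz : Tendsto (fun x : ℝ => x ^ ((1 : ℝ) / 2)) (nhdsWithin 0 (Set.Ioi 0)) (nhds 0) := by
    have : ContinuousAt (fun x : ℝ => x ^ ((1 : ℝ) / 2)) 0 :=
      Real.continuousAt_rpow_const _ _ (Or.inr (by norm_num))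
    have h := this.tendsto
    rw [Real.zero_rpow (by norm_num)] at h
    exact h.mono_left nhdsWithin_le_nhds
  have hd := squeeze_zero_norm' (f := fun x : ℝ =>
    ((∫ ω, Real.exp (x * (ξ ω : ℝ)) ∂ℙ) - 1) / x ^ ((3 : ℝ) / 2)
        - ∫ t in Set.Ioi 0, lapF a x t) ?_ hz
  · have := hd.add hT
    simpa using this
  · filter_upwards [Ioc_mem_nhdsGT (zero_lt_one (α := ℝ))] with x hx
    exact hdec x hx.1 hx.2
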